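/- Let G be a strongly connected finite directed multigraph on vertex set V. Then G is Eulerian (every vertex has indegree equal to outdegree) if and only if the sandpile group is independent of the choice of sink, i.e. K(G,s) ≅ K(G,s') for all vertices s, s'. -/

import Mathlib

open Finset

variable {V : Type} [Fintype V] [DecidableEq V]

/-- Outdegree of `v`. -/
def outdeg (d : V → V → ℕ) (v : V) : ℕ := ∑ w, d v w

/-- Indegree of `v`. -/
def indeg (d : V → V → ℕ) (v : V) : ℕ := ∑ w, d w v

/-- The graph Laplacian. -/
def lap (d : V → V → ℕ) : Matrix V V ℤ :=
  Matrix.of fun v w => if v = w then (outdeg d v : ℤ) - d v v else -(d w v : ℤ)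

/-- Strong connectivity. -/
def StronglyConnected (d : V → V → ℕ) : Prop :=
  ∀ u v : V, Relation.ReflTransGen (fun a b => 1 ≤ d a b) u v

/-- Eulerian: every vertex has indegree equal to outdegree. -/
def Eulerian (d : V → V → ℕ) : Prop := ∀ v, indeg d v = outdeg d v

/-- Reduced Laplacian with the row and column of `s` deleted. -/
def redLap (d : V → V → ℕ) (s : V) : Matrix {v : V // v ≠ s} {v : V // v ≠ s} ℤ :=
  Matrix.of fun v w => lap d v.1 w.1

/-- Number of oriented spanning trees rooted at `s` (matrix-tree theorem). -/
def kappa (d : V → V → ℕ) (s : V) : ℤ := (redLap d s).det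

/-- Pham index. -/
def phamIndex (d : V → V → ℕ) : ℤ := Finset.univ.gcd (kappa d)

/-- Integer column span of the Laplacian. -/
def lapLattice (d : V → V → ℕ) : Submodule ℤ (V → ℤ) :=
  LinearMap.range (lap d).mulVecLin

/-- Integer column span of the reduced Laplacian. -/
def redLattice (d : V → V → ℕ) (s : V) : Submodule ℤ ({v : V // v ≠ s} → ℤ) :=
  LinearMap.range (redLap d s).mulVecLin

/-- Integer vectors with coordinate sum zero. -/
def zeroSum (V : Type) [Fintype V] : Submodule ℤ (V → ℤ) where
  carrier := {f | ∑ v, f v = 0}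
  add_mem' := by
    intro a b ha hb
    simp only [Set.mem_setOf_eq] at *
    simp [Finset.sum_add_distrib, ha, hb]
  zero_mem' := by simp
  smul_mem' := by
    intro c f hf
    simp only [Set.mem_setOf_eq, Pi.smul_apply, smul_eq_mul] at *
    simp [← Finset.mul_sum, hf]

/-- The sandpile `β_s`, recording edge multiplicities out of `s`. -/
def betaS (d : V → V → ℕ) (s : V) : {v : V // v ≠ s} → ℤ := fun v => (d s v.1 : ℤ)

/-- Stable chip configuration. -/
def Stable (d : V → V → ℕ) (σ : V → ℤ) : Prop := ∀ v, σ v < (outdeg d v : ℤ)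

/-- Result of firing vertex `v`. -/
def fire (d : V → V → ℕ) (σ : V → ℤ) (v : V) : V → ℤ := fun w => σ w - lap d w v

/-- One legal firing step. -/
def LegalStep (d : V → V → ℕ) (σ τ : V → ℤ) : Prop :=
  ∃ v, (outdeg d v : ℤ) ≤ σ v ∧ τ = fire d σ v

/-- `σ` stabilizes if some legal firing sequence from `σ` ends in a stable configuration. -/
def Stabilizes (d : V → V → ℕ) (σ : V → ℤ) : Prop :=
  ∃ τ, Relation.ReflTransGen (LegalStep d) σ τ ∧ Stable d τ

/-- Legal firing sequences, recorded as lists of fired vertices. -/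
inductive LegalSeq (d : V → V → ℕ) : (V → ℤ) → List V → Prop
  | nil (σ : V → ℤ) : LegalSeq d σ []
  | cons (σ : V → ℤ) (v : V) (l : List V) :
      (outdeg d v : ℤ) ≤ σ v → LegalSeq d (fire d σ v) l → LegalSeq d σ (v :: l)

/-- Period vector. -/
def IsPeriodVec (d : V → V → ℕ) (p : V → ℕ) : Prop :=
  p ≠ 0 ∧ (lap d).mulVec (fun v => (p v : ℤ)) = 0

/-- Simple directed path from `x` to `y`, as a list of distinct vertices. -/
def IsSimplePath (d : V → V → ℕ) (x y : V) (p : List V) : Prop :=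
  p.Nodup ∧ p.head? = some x ∧ p.getLast? = some y ∧ p.Chain' (fun a b => 1 ≤ d a b)

theorem lap_apply (d : V → V → ℕ) (v w : V) :
    lap d v w = (if v = w then (outdeg d v : ℤ) else 0) - d w v := by
  simp only [lap, Matrix.of_apply]
  split_ifs with hvw
  · rw [hvw]
  · rw [zero_sub]

theorem lap_mulVec_apply (d : V → V → ℕ) (x : V → ℤ) (v : V) :
    (lap d).mulVec x v = outdeg d v * x v - ∑ w, (d w v : ℤ) * x w := by
  simp [Matrix.mulVec, dotProduct, lap_apply, sub_mul, Finset.sum_sub_distrib]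

theorem vecMul_lap_apply (d : V → V → ℕ) (y : V → ℤ) (w : V) :
    Matrix.vecMul y (lap d) w = ∑ v, (d w v : ℤ) * (y w - y v) := by
  have hout : ∑ v, y v * (if v = w then (outdeg d v : ℤ) else 0) =
      ∑ v, (d w v : ℤ) * y w := by
    rw [← Finset.sum_mul]
    simp [outdeg, mul_comm]
  simp only [Matrix.vecMul, dotProduct, lap_apply, mul_sub, Finset.sum_sub_distrib, hout]
  simp only [mul_comm]

theorem sum_lap_mulVec (d : V → V → ℕ) (x : V → ℤ) : ∑ v, (lap d).mulVec x v = 0 := by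
  have hone : Matrix.vecMul (1 : V → ℤ) (lap d) = 0 := by
    ext w
    simp [vecMul_lap_apply]
  rw [← one_dotProduct, Matrix.dotProduct_mulVec, hone, zero_dotProduct]

theorem lap_mulVec_one (d : V → V → ℕ) (hE : Eulerian d) : (lap d).mulVec 1 = 0 := by
  ext v
  have := hE v
  simp only [indeg] at this
  simp [lap_mulVec_apply, ← this]

/-- Maximum principle, for functions that are harmonic away from `s`. -/
theorem StronglyConnected.le_of_vecMul_lap_eq_zero {d : V → V → ℕ} (h : StronglyConnected d)
    {y : V → ℤ} {s : V} (hy : ∀ w, w ≠ s → Matrix.vecMul y (lap d) w = 0) (v : V) :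
    y v ≤ y s := by
  obtain ⟨m, -, hm⟩ := Finset.exists_max_image Finset.univ y ⟨s, Finset.mem_univ s⟩
  have hpath : ∀ b, Relation.ReflTransGen (fun a b => 1 ≤ d a b) m b →
      y b = y m ∨ y s = y m := by
    intro b hb
    induction hb with
    | refl => exact Or.inl rfl
    | @tail a b _ hab ih =>
      rcases ih with ha | hs
      · by_cases has : a = s
        · exact Or.inr (has ▸ ha)
        have hsum := hy a has
        rw [vecMul_lap_apply, Finset.sum_eq_zero_iff_of_nonneg] at hsum
        · have hb := hsum b (Finset.mem_univ b)
          have hd : (d a b : ℤ) ≠ 0 := by exact_mod_cast (by omega : d a b ≠ 0)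
          rcases mul_eq_zero.mp hb with h0 | h0
          · exact absurd h0 hd
          · exact Or.inl (by omega)
        · intro c _
          have := hm c (Finset.mem_univ c)
          exact mul_nonneg (Int.natCast_nonneg _) (by omega)
      · exact Or.inr hs
  have := hpath s (h m s)
  have := hm v (Finset.mem_univ v)
  omega

theorem StronglyConnected.eq_of_vecMul_lap_eq_zero {d : V → V → ℕ} (h : StronglyConnected d)
    {y : V → ℤ} {s : V} (hy : ∀ w, w ≠ s → Matrix.vecMul y (lap d) w = 0) (v : V) :
    y v = y s := by
  refine le_antisymm (h.le_of_vecMul_lap_eq_zero hy v) ?_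
  have := h.le_of_vecMul_lap_eq_zero (y := -y) (s := s)
    (fun w hw => by rw [Matrix.neg_vecMul, Pi.neg_apply, hy w hw, neg_zero]) v
  simpa using this

theorem StronglyConnected.kappa_ne_zero {d : V → V → ℕ} (h : StronglyConnected d) (s : V) :
    kappa d s ≠ 0 := by
  intro h0
  obtain ⟨y, hy0, hy⟩ := Matrix.exists_vecMul_eq_zero_iff.mpr h0
  let z : V → ℤ := fun v => if hv : v ≠ s then y ⟨v, hv⟩ else 0
  have hz : ∀ w, w ≠ s → Matrix.vecMul z (lap d) w = 0 := by
    intro w hw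
    refine Eq.trans ?_ (congrFun hy ⟨w, hw⟩)
    simp only [Matrix.vecMul, dotProduct]
    rw [Fintype.sum_eq_add_sum_subtype_ne _ s]
    simp only [z, ne_eq, not_true_eq_false, dite_false, zero_mul, zero_add]
    refine Finset.sum_congr rfl fun v _ => ?_
    rw [dif_pos v.2]
    rfl
  refine hy0 (funext fun v => ?_)
  have := h.eq_of_vecMul_lap_eq_zero hz v.1
  simpa [z, v.2] using this

theorem adjugate_lap_self (d : V → V → ℕ) (s : V) : (lap d).adjugate s s = kappa d s := by
  rw [Matrix.adjugate_apply, Matrix.twoBlockTriangular_det _ (fun v => v ≠ s)]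
  · have h1 : Matrix.toSquareBlockProp ((lap d).updateRow s (Pi.single s 1)) (fun v => v ≠ s) =
        redLap d s := by
      ext v w
      simp [Matrix.toSquareBlockProp, redLap, Matrix.updateRow_ne v.2]
    have h2 : Matrix.toSquareBlockProp ((lap d).updateRow s (Pi.single s 1))
        (fun v => ¬ v ≠ s) = 1 := by
      ext ⟨v, hv⟩ ⟨w, hw⟩
      obtain rfl := not_not.mp hv
      obtain rfl := not_not.mp hw
      simp [Matrix.toSquareBlockProp]
    rw [h1, h2, Matrix.det_one, mul_one, kappa]
  · intro v hv w hw
    obtain rfl := not_not.mp hv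
    simp [hw]

theorem det_lap [Nonempty V] (d : V → V → ℕ) : (lap d).det = 0 := by
  refine Matrix.exists_vecMul_eq_zero_iff.mp ⟨1, one_ne_zero, ?_⟩
  ext w
  simp [vecMul_lap_apply]

theorem StronglyConnected.lap_mulVec_kappa {d : V → V → ℕ} (h : StronglyConnected d) :
    (lap d).mulVec (kappa d) = 0 := by
  ext v
  have : Nonempty V := ⟨v⟩
  have hrow : ∀ u, (lap d).adjugate u v = kappa d u := by
    intro u
    rw [← adjugate_lap_self]
    refine h.eq_of_vecMul_lap_eq_zero (y := (lap d).adjugate u) (fun w _ => ?_) v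
    have := congrFun (congrFun (Matrix.adjugate_mul (lap d)) u) w
    rwa [det_lap, zero_smul, Matrix.mul_apply_eq_vecMul] at this
  have := congrFun (congrFun (Matrix.mul_adjugate (lap d)) v) v
  rw [det_lap, zero_smul, Matrix.mul_apply] at this
  simpa [hrow, Matrix.mulVec, dotProduct] using this

theorem StronglyConnected.card_quotient_redLattice {d : V → V → ℕ} (h : StronglyConnected d)
    (s : V) :
    Nat.card (({v : V // v ≠ s} → ℤ) ⧸ redLattice d s) = (kappa d s).natAbs := by
  have hinj : Function.Injective (redLap d s).mulVecLin :=
    Matrix.mulVec_injective_of_det_ne_zero (h.kappa_ne_zero s)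
  let e := LinearEquiv.ofInjective _ hinj
  rw [redLattice, ← Submodule.natAbs_det_equiv _ e]
  have : (LinearMap.range (redLap d s).mulVecLin).subtype ∘ₗ
      AddMonoidHom.toIntLinearMap (e : _ →+ LinearMap.range (redLap d s).mulVecLin) =
      (redLap d s).mulVecLin := by
    ext; rfl
  rw [this, ← Matrix.toLin'_apply', LinearMap.det_toLin', kappa]

theorem StronglyConnected.eulerian_of_natAbs_kappa_eq {d : V → V → ℕ} (h : StronglyConnected d)
    (hk : ∀ s s', (kappa d s).natAbs = (kappa d s').natAbs) : Eulerian d := by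
  have hle : ∀ v ∈ Finset.univ, outdeg d v ≤ indeg d v := by
    intro v _
    have hv := congrFun h.lap_mulVec_kappa v
    rw [lap_mulVec_apply, Pi.zero_apply, sub_eq_zero] at hv
    have habs : ∀ w, |kappa d w| = |kappa d v| := fun w => by
      rw [Int.abs_eq_natAbs, Int.abs_eq_natAbs, hk w v]
    have hmul : (outdeg d v : ℤ) * |kappa d v| ≤ indeg d v * |kappa d v| := by
      calc (outdeg d v : ℤ) * |kappa d v| = |∑ w, (d w v : ℤ) * kappa d w| := by
            rw [← hv, abs_mul, Nat.abs_cast]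
        _ ≤ ∑ w, |(d w v : ℤ) * kappa d w| := Finset.abs_sum_le_sum_abs _ _
        _ = indeg d v * |kappa d v| := by
            simp only [abs_mul, Nat.abs_cast, habs, indeg, Nat.cast_sum, Finset.sum_mul]
    exact_mod_cast le_of_mul_le_mul_right hmul (abs_pos.mpr (h.kappa_ne_zero v))
  have hsum : ∑ v, outdeg d v = ∑ v, indeg d v := Finset.sum_comm
  intro v
  exact ((Finset.sum_eq_sum_iff_of_le hle).mp hsum v (Finset.mem_univ v)).symm

/-- Restriction of coordinates away from `s`, an isomorphism on vectors with sum zero. -/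
noncomputable def zeroSumEquiv (s : V) : zeroSum V ≃ₗ[ℤ] ({v : V // v ≠ s} → ℤ) :=
  LinearEquiv.ofBijective
    ((LinearMap.funLeft ℤ ℤ (Subtype.val : {v : V // v ≠ s} → V)) ∘ₗ (zeroSum V).subtype) <| by
    constructor
    · rw [← LinearMap.ker_eq_bot, LinearMap.ker_eq_bot']
      intro f hf
      have hf0 : ∀ v : {v : V // v ≠ s}, f.1 v.1 = 0 := fun v => congrFun hf v
      have hsum : ∑ v, f.1 v = 0 := f.2
      rw [Fintype.sum_eq_add_sum_subtype_ne _ s] at hsum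
      simp only [hf0, Finset.sum_const_zero, add_zero] at hsum
      ext v
      by_cases hv : v = s
      · rw [hv]; exact hsum
      · exact hf0 ⟨v, hv⟩
    · intro g
      refine ⟨⟨fun v => if hv : v ≠ s then g ⟨v, hv⟩ else -∑ w, g w, ?_⟩, ?_⟩
      · change ∑ v, _ = 0
        rw [Fintype.sum_eq_add_sum_subtype_ne _ s]
        have hg : ∀ v : {v : V // v ≠ s},
            (if hv : v.1 ≠ s then g ⟨v.1, hv⟩ else -∑ w, g w) = g v := fun v => dif_pos v.2
        simp only [hg, ne_eq, not_true_eq_false, dite_false, neg_add_cancel]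
      · ext v
        simp [LinearMap.funLeft, v.2]

@[simp]
theorem zeroSumEquiv_apply (s : V) (f : zeroSum V) (v : {v : V // v ≠ s}) :
    zeroSumEquiv s f v = f.1 v := rfl

theorem lap_mulVec_eq_redLap_mulVec (d : V → V → ℕ) {s : V} {x : V → ℤ} (hx : x s = 0)
    (v : {v : V // v ≠ s}) :
    (lap d).mulVec x v = (redLap d s).mulVec (fun w => x w.1) v := by
  simp only [Matrix.mulVec, dotProduct]
  rw [Fintype.sum_eq_add_sum_subtype_ne _ s, hx, mul_zero, zero_add]
  rfl

theorem map_zeroSumEquiv_lapLattice {d : V → V → ℕ} (hE : Eulerian d) (s : V) :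
    ((lapLattice d).comap (zeroSum V).subtype).map (zeroSumEquiv s).toLinearMap =
      redLattice d s := by
  ext g
  constructor
  · rintro ⟨f, ⟨x, hx⟩, rfl⟩
    have hshift : (lap d).mulVec (x - x s • 1) = f.1 := by
      rw [Matrix.mulVec_sub, Matrix.mulVec_smul, lap_mulVec_one d hE, smul_zero, sub_zero]
      exact hx
    refine ⟨fun w => (x - x s • 1 : V → ℤ) w.1, ?_⟩
    ext v
    rw [Matrix.mulVecLin_apply, ← lap_mulVec_eq_redLap_mulVec d (by simp), hshift]
    rfl
  · rintro ⟨y, rfl⟩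
    let x : V → ℤ := fun v => if hv : v ≠ s then y ⟨v, hv⟩ else 0
    refine ⟨⟨(lap d).mulVec x, sum_lap_mulVec d x⟩, ⟨x, rfl⟩, ?_⟩
    ext v
    have hx : (fun w : {v : V // v ≠ s} => x w.1) = y := by
      ext w
      simp [x, w.2]
    rw [Matrix.mulVecLin_apply, ← hx, ← lap_mulVec_eq_redLap_mulVec d (by simp [x])]
    rfl

/-- For Eulerian graphs the sandpile group is a quotient of `zeroSum V`, whatever the sink. -/
noncomputable def quotientRedLatticeEquiv {d : V → V → ℕ} (hE : Eulerian d) (s : V) :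
    (zeroSum V ⧸ (lapLattice d).comap (zeroSum V).subtype) ≃ₗ[ℤ]
      (({v : V // v ≠ s} → ℤ) ⧸ redLattice d s) :=
  Submodule.Quotient.equiv _ _ (zeroSumEquiv s) (map_zeroSumEquiv_lapLattice hE s)

theorem stmt4 (d : V → V → ℕ) (h : StronglyConnected d) :
    Eulerian d ↔ ∀ s s' : V, Nonempty (
      (({v : V // v ≠ s} → ℤ) ⧸ redLattice d s) ≃+
      (({v : V // v ≠ s'} → ℤ) ⧸ redLattice d s')) := by
  refine ⟨fun hE s s' => ⟨((quotientRedLatticeEquiv hE s).symm.trans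
    (quotientRedLatticeEquiv hE s')).toAddEquiv⟩, fun hK => ?_⟩
  refine h.eulerian_of_natAbs_kappa_eq fun s s' => ?_
  obtain ⟨e⟩ := hK s s'
  rw [← h.card_quotient_redLattice, ← h.card_quotient_redLattice]
  exact Nat.card_congr e.toEquiv
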